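/- Let V, a, b, c, d, K₁₁, K₁₂, K₂₂, B¹, B², U : ℝ² → ℝ be smooth, let H(q,p) = ½(p₁² + p₂²) + V(q), and let G(q,p) = a p₁³ + 3b p₁²p₂ + 3c p₁p₂² + d p₂³ + K₁₁ p₁² + 2K₁₂ p₁p₂ + K₂₂ p₂² + B¹ p₁ + B² p₂ + U (coefficients evaluated at q). If {H,G} = 0 at every point of ℝ² × ℝ², then the leading coefficients (a,b,c,d) satisfy the valence-three Killing tensor equations ∂₁a = 0, ∂₂a + 3∂₁b = 0, ∂₂b + ∂₁c = 0, 3∂₂c + ∂₁d = 0, ∂₂d = 0, and (K₁₁,K₁₂,K₂₂) satisfy the valence-two Killing tensor equations ∂₁K₁₁ = 0, ∂₂K₁₁ + 2∂₁K₁₂ = 0, ∂₁K₂₂ + 2∂₂K₁₂ = 0, ∂₂K₂₂ = 0; no such constraint need hold for (B¹,B²) or U alone. -/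

import Mathlib

/- STATEMENT 4: If the general cubic-in-momenta function G Poisson-commutes with the
natural Hamiltonian, then its leading (cubic) coefficients form a valence-three Killing
tensor and its quadratic coefficients form a valence-two Killing tensor of the flat
Euclidean metric. -/

noncomputable section

/-- Partial derivative with respect to q₁. -/
def pd1 (f : ℝ × ℝ → ℝ) (q : ℝ × ℝ) : ℝ := fderiv ℝ f q (1, 0)

/-- Partial derivative with respect to q₂. -/
def pd2 (f : ℝ × ℝ → ℝ) (q : ℝ × ℝ) : ℝ := fderiv ℝ f q (0, 1)

/-- Canonical Poisson bracket on the phase space ℝ² × ℝ². -/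
def poissonBracket (F G : (ℝ × ℝ) × (ℝ × ℝ) → ℝ) (z : (ℝ × ℝ) × (ℝ × ℝ)) : ℝ :=
  fderiv ℝ F z ((1, 0), (0, 0)) * fderiv ℝ G z ((0, 0), (1, 0)) -
  fderiv ℝ F z ((0, 0), (1, 0)) * fderiv ℝ G z ((1, 0), (0, 0)) +
  fderiv ℝ F z ((0, 1), (0, 0)) * fderiv ℝ G z ((0, 0), (0, 1)) -
  fderiv ℝ F z ((0, 0), (0, 1)) * fderiv ℝ G z ((0, 1), (0, 0))

/-- The derivative of a term `f(q) p₁ⁱ p₂ʲ` on phase space. -/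
theorem hasFDerivAt_mul_monomial {f : ℝ × ℝ → ℝ} (hf : Differentiable ℝ f) (i j : ℕ)
    (z : (ℝ × ℝ) × (ℝ × ℝ)) :
    HasFDerivAt (fun z : (ℝ × ℝ) × (ℝ × ℝ) => f z.1 * (z.2.1 ^ i * z.2.2 ^ j))
      (f z.1 • (z.2.1 ^ i • (j * z.2.2 ^ (j - 1)) •
            (ContinuousLinearMap.snd ℝ ℝ ℝ).comp (ContinuousLinearMap.snd ℝ (ℝ × ℝ) (ℝ × ℝ)) +
          z.2.2 ^ j • (i * z.2.1 ^ (i - 1)) •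
            (ContinuousLinearMap.fst ℝ ℝ ℝ).comp (ContinuousLinearMap.snd ℝ (ℝ × ℝ) (ℝ × ℝ))) +
        (z.2.1 ^ i * z.2.2 ^ j) •
          (fderiv ℝ f z.1).comp (ContinuousLinearMap.fst ℝ (ℝ × ℝ) (ℝ × ℝ))) z := by
  have hfz : HasFDerivAt (fun z : (ℝ × ℝ) × (ℝ × ℝ) => f z.1) _ z :=
    (hf z.1).hasFDerivAt.comp z hasFDerivAt_fst
  have hx : HasFDerivAt (fun z : (ℝ × ℝ) × (ℝ × ℝ) => z.2.1) _ z :=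
    ((ContinuousLinearMap.fst ℝ ℝ ℝ).comp
      (ContinuousLinearMap.snd ℝ (ℝ × ℝ) (ℝ × ℝ))).hasFDerivAt
  have hy : HasFDerivAt (fun z : (ℝ × ℝ) × (ℝ × ℝ) => z.2.2) _ z :=
    ((ContinuousLinearMap.snd ℝ ℝ ℝ).comp
      (ContinuousLinearMap.snd ℝ (ℝ × ℝ) (ℝ × ℝ))).hasFDerivAt
  exact (hfz.mul ((hx.pow i).mul (hy.pow j))).congr_fderiv (by simp [nsmul_eq_mul])

/-- A real quartic that vanishes everywhere has zero coefficients. -/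
theorem quartic_coeffs_eq_zero {c₀ c₁ c₂ c₃ c₄ : ℝ}
    (h : ∀ t : ℝ, c₀ + c₁ * t + c₂ * t ^ 2 + c₃ * t ^ 3 + c₄ * t ^ 4 = 0) :
    c₀ = 0 ∧ c₁ = 0 ∧ c₂ = 0 ∧ c₃ = 0 ∧ c₄ = 0 := by
  have h₀ := h 0
  have h₁ := h 1
  have h₂ := h (-1)
  have h₃ := h 2
  have h₄ := h (-2)
  norm_num at h₀ h₁ h₂ h₃ h₄
  refine ⟨?_, ?_, ?_, ?_, ?_⟩ <;> linarith

theorem leading_coefficients_are_killing_tensors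
    (V a b c d K₁₁ K₁₂ K₂₂ B₁ B₂ U : ℝ × ℝ → ℝ)
    (hV : ContDiff ℝ (⊤ : ℕ∞) V) (ha : ContDiff ℝ (⊤ : ℕ∞) a)
    (hb : ContDiff ℝ (⊤ : ℕ∞) b) (hc : ContDiff ℝ (⊤ : ℕ∞) c)
    (hd : ContDiff ℝ (⊤ : ℕ∞) d) (hK₁₁ : ContDiff ℝ (⊤ : ℕ∞) K₁₁)
    (hK₁₂ : ContDiff ℝ (⊤ : ℕ∞) K₁₂) (hK₂₂ : ContDiff ℝ (⊤ : ℕ∞) K₂₂)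
    (hB₁ : ContDiff ℝ (⊤ : ℕ∞) B₁) (hB₂ : ContDiff ℝ (⊤ : ℕ∞) B₂)
    (hU : ContDiff ℝ (⊤ : ℕ∞) U)
    (H G : (ℝ × ℝ) × (ℝ × ℝ) → ℝ)
    (hH : H = fun z => (z.2.1 ^ 2 + z.2.2 ^ 2) / 2 + V z.1)
    (hG : G = fun z =>
      a z.1 * z.2.1 ^ 3 + 3 * b z.1 * z.2.1 ^ 2 * z.2.2 +
      3 * c z.1 * z.2.1 * z.2.2 ^ 2 + d z.1 * z.2.2 ^ 3 +
      K₁₁ z.1 * z.2.1 ^ 2 + 2 * K₁₂ z.1 * z.2.1 * z.2.2 + K₂₂ z.1 * z.2.2 ^ 2 +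
      B₁ z.1 * z.2.1 + B₂ z.1 * z.2.2 + U z.1)
    (hHG : ∀ z, poissonBracket H G z = 0) :
    ∀ q : ℝ × ℝ,
      -- valence-three Killing tensor equations for (a,b,c,d)
      (pd1 a q = 0 ∧ pd2 a q + 3 * pd1 b q = 0 ∧ pd2 b q + pd1 c q = 0 ∧
        3 * pd2 c q + pd1 d q = 0 ∧ pd2 d q = 0) ∧
      -- valence-two Killing tensor equations for (K₁₁,K₁₂,K₂₂)
      (pd1 K₁₁ q = 0 ∧ pd2 K₁₁ q + 2 * pd1 K₁₂ q = 0 ∧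
        pd1 K₂₂ q + 2 * pd2 K₁₂ q = 0 ∧ pd2 K₂₂ q = 0) := by
  intro q
  have bracket_eq : ∀ x y : ℝ,
      pd1 V q * (3 * a q * x ^ 2 + 6 * b q * x * y + 3 * c q * y ^ 2 +
        2 * K₁₁ q * x + 2 * K₁₂ q * y + B₁ q) +
      pd2 V q * (3 * b q * x ^ 2 + 6 * c q * x * y + 3 * d q * y ^ 2 +
        2 * K₁₂ q * x + 2 * K₂₂ q * y + B₂ q) -
      x * (pd1 a q * x ^ 3 + 3 * pd1 b q * x ^ 2 * y + 3 * pd1 c q * x * y ^ 2 +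
        pd1 d q * y ^ 3 + pd1 K₁₁ q * x ^ 2 + 2 * pd1 K₁₂ q * x * y + pd1 K₂₂ q * y ^ 2 +
        pd1 B₁ q * x + pd1 B₂ q * y + pd1 U q) -
      y * (pd2 a q * x ^ 3 + 3 * pd2 b q * x ^ 2 * y + 3 * pd2 c q * x * y ^ 2 +
        pd2 d q * y ^ 3 + pd2 K₁₁ q * x ^ 2 + 2 * pd2 K₁₂ q * x * y + pd2 K₂₂ q * y ^ 2 +
        pd2 B₁ q * x + pd2 B₂ q * y + pd2 U q) = 0 := by
    intro x y
    have D {f : ℝ × ℝ → ℝ} (hf : ContDiff ℝ (⊤ : ℕ∞) f) : Differentiable ℝ f :=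
      hf.differentiable (by simp)
    have half : Differentiable ℝ (fun _ : ℝ × ℝ => (1 / 2 : ℝ)) := differentiable_const _
    have dH : HasFDerivAt H _ (q, (x, y)) :=
      (((hasFDerivAt_mul_monomial half 2 0 _).add (hasFDerivAt_mul_monomial half 0 2 _)).add
        (hasFDerivAt_mul_monomial (D hV) 0 0 _)).congr_of_eventuallyEq
        (.of_forall fun z => by simp [hH]; ring)
    have dG : HasFDerivAt G _ (q, (x, y)) :=
      ((((((((((hasFDerivAt_mul_monomial (D ha) 3 0 _).add
        ((hasFDerivAt_mul_monomial (D hb) 2 1 _).const_mul 3)).add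
        ((hasFDerivAt_mul_monomial (D hc) 1 2 _).const_mul 3)).add
        (hasFDerivAt_mul_monomial (D hd) 0 3 _)).add
        (hasFDerivAt_mul_monomial (D hK₁₁) 2 0 _)).add
        ((hasFDerivAt_mul_monomial (D hK₁₂) 1 1 _).const_mul 2)).add
        (hasFDerivAt_mul_monomial (D hK₂₂) 0 2 _)).add
        (hasFDerivAt_mul_monomial (D hB₁) 1 0 _)).add
        (hasFDerivAt_mul_monomial (D hB₂) 0 1 _)).add
        (hasFDerivAt_mul_monomial (D hU) 0 0 _)).congr_of_eventuallyEq
        (.of_forall fun z => by simp [hG]; ring)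
    have h := hHG (q, (x, y))
    rw [poissonBracket, dH.fderiv, dG.fderiv] at h
    simp [show ((0 : ℝ), (0 : ℝ)) = 0 from rfl] at h
    simp only [pd1, pd2]
    linear_combination h
  have homogeneous_parts (y : ℝ) := quartic_coeffs_eq_zero
    (c₀ := pd1 V q * B₁ q + pd2 V q * B₂ q)
    (c₁ := pd1 V q * (2 * K₁₁ q + 2 * K₁₂ q * y) + pd2 V q * (2 * K₁₂ q + 2 * K₂₂ q * y) -
      pd1 U q - y * pd2 U q)
    (c₂ := pd1 V q * (3 * a q + 6 * b q * y + 3 * c q * y ^ 2) +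
      pd2 V q * (3 * b q + 6 * c q * y + 3 * d q * y ^ 2) -
      (pd1 B₁ q + pd1 B₂ q * y) - y * (pd2 B₁ q + pd2 B₂ q * y))
    (c₃ := -(pd1 K₁₁ q + 2 * pd1 K₁₂ q * y + pd1 K₂₂ q * y ^ 2) -
      y * (pd2 K₁₁ q + 2 * pd2 K₁₂ q * y + pd2 K₂₂ q * y ^ 2))
    (c₄ := -(pd1 a q + 3 * pd1 b q * y + 3 * pd1 c q * y ^ 2 + pd1 d q * y ^ 3) -
      y * (pd2 a q + 3 * pd2 b q * y + 3 * pd2 c q * y ^ 2 + pd2 d q * y ^ 3))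
    fun t => by linear_combination bracket_eq t (t * y)
  obtain ⟨a₀, a₁, a₂, a₃, a₄⟩ := quartic_coeffs_eq_zero
    (c₀ := pd1 a q) (c₁ := pd2 a q + 3 * pd1 b q) (c₂ := 3 * (pd2 b q + pd1 c q))
    (c₃ := 3 * pd2 c q + pd1 d q) (c₄ := pd2 d q)
    fun y => by linear_combination -(homogeneous_parts y).2.2.2.2
  obtain ⟨k₀, k₁, k₂, k₃, -⟩ := quartic_coeffs_eq_zero
    (c₀ := pd1 K₁₁ q) (c₁ := pd2 K₁₁ q + 2 * pd1 K₁₂ q) (c₂ := pd1 K₂₂ q + 2 * pd2 K₁₂ q)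
    (c₃ := pd2 K₂₂ q) (c₄ := 0)
    fun y => by linear_combination -(homogeneous_parts y).2.2.2.1
  exact ⟨⟨a₀, a₁, by linarith, a₃, a₄⟩, k₀, k₁, k₂, k₃⟩
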